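/- arXiv:2010.03619 — 2 statements merged into one kernel-verified Lean document; each statement's English description precedes it below -/
import Mathlib

section
/- For every real z one has the strict inequality 2·(φ(z)/Ψ(z))² − 3·z·(φ(z)/Ψ(z)) + z² > 1; equivalently, (φ(z)/Ψ(z) − z)·(2·φ(z)/Ψ(z) − z) > 1. -/
/-- The standard normal density `φ(z) = exp(-z²/2)/√(2π)`. -/
noncomputable def npdf (z : ℝ) : ℝ := (Real.sqrt (2 * Real.pi))⁻¹ * Real.exp (-z ^ 2 / 2)

/-- The standard normal distribution function `Φ(y) = ∫_{-∞}^y φ(z) dz`. -/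
noncomputable def ncdf (y : ℝ) : ℝ := ∫ z in Set.Iic y, npdf z

/-- The standard normal tail function `Ψ(y) = 1 - Φ(y)`. -/
noncomputable def ntail (y : ℝ) : ℝ := 1 - ncdf y

/-- The function `F(y) = φ(y) - y·Ψ(y)`. -/
noncomputable def Fstat (y : ℝ) : ℝ := npdf y - y * ntail y

lemma npdf_pos (z : ℝ) : 0 < npdf z := by
  unfold npdf; positivity

lemma npdf_continuous : Continuous npdf := by
  unfold npdf; fun_prop

lemma npdf_eq : npdf = ProbabilityTheory.gaussianPDFReal 0 1 := by
  funext z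
  simp [npdf, ProbabilityTheory.gaussianPDFReal]

lemma npdf_integrable : MeasureTheory.Integrable npdf := by
  rw [npdf_eq]; exact ProbabilityTheory.integrable_gaussianPDFReal 0 1

lemma npdf_integral : ∫ z, npdf z = 1 := by
  rw [npdf_eq]; exact ProbabilityTheory.integral_gaussianPDFReal_eq_one 0 one_ne_zero

lemma ntail_tendsto : Filter.Tendsto ntail Filter.atTop (nhds 0) := by
  have h := (MeasureTheory.aecover_Iic (μ := MeasureTheory.volume)
    (Filter.tendsto_id (α := ℝ) (x := Filter.atTop))).integral_tendsto_of_countably_generated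
    npdf_integrable
  rw [npdf_integral] at h
  have h2 := h.const_sub 1
  rw [sub_self] at h2
  exact h2

lemma ntail_hasDerivAt (y : ℝ) : HasDerivAt ntail (-npdf y) y := by
  have h1 : ∀ x, ntail x = (1 - ncdf 0) - ∫ t in (0:ℝ)..x, npdf t := by
    intro x
    have := intervalIntegral.integral_Iic_sub_Iic (μ := MeasureTheory.volume)
      (npdf_integrable.integrableOn (s := Set.Iic 0))
      (npdf_integrable.integrableOn (s := Set.Iic x))
    unfold ntail ncdf
    linarith
  have h2 := (npdf_continuous.integral_hasStrictDerivAt 0 y).hasDerivAt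
  have := h2.const_sub (1 - ncdf 0)
  rwa [← funext h1] at this

lemma npdf_hasDerivAt (y : ℝ) : HasDerivAt npdf (-y * npdf y) y := by
  have h : HasDerivAt (fun z : ℝ => -z ^ 2 / 2) (-y) y := by
    have := ((hasDerivAt_pow 2 y).neg).div_const 2
    refine HasDerivAt.congr_deriv this ?_
    norm_num
    try ring
  have := (h.exp).const_mul (Real.sqrt (2 * Real.pi))⁻¹
  refine HasDerivAt.congr_deriv this ?_
  unfold npdf; ring

lemma npdf_tendsto : Filter.Tendsto npdf Filter.atTop (nhds 0) := by
  have h : Filter.Tendsto (fun z : ℝ => -z ^ 2 / 2) Filter.atTop Filter.atBot := by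
    have := (Filter.tendsto_pow_atTop (α := ℝ) (two_ne_zero)).atTop_div_const (two_pos)
    have := Filter.tendsto_neg_atTop_atBot.comp this
    refine this.congr fun z => ?_
    simp [neg_div]
  have h2 := (Real.tendsto_exp_atBot.comp h).const_mul (Real.sqrt (2 * Real.pi))⁻¹
  rw [mul_zero] at h2
  exact h2

/-- A function with positive derivative on `(-1,∞)` or wider, tending to zero, is negative. -/
lemma neg_of_deriv_pos {f f' : ℝ → ℝ} {z : ℝ} (hd : ∀ x, z ≤ x → HasDerivAt f (f' x) x)
    (hp : ∀ x, z ≤ x → 0 < f' x) (hl : Filter.Tendsto f Filter.atTop (nhds 0)) : f z < 0 := by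
  have hm : StrictMonoOn f (Set.Ici z) := by
    apply strictMonoOn_of_deriv_pos (convex_Ici z)
    · intro x hx
      exact (hd x hx).continuousAt.continuousWithinAt
    · intro x hx
      rw [interior_Ici] at hx
      rw [(hd x (le_of_lt hx)).deriv]
      exact hp x (le_of_lt hx)
  have h1 : f z < f (z + 1) := hm (by simp) (by simp) (by simp)
  have h2 : f (z + 1) ≤ 0 := by
    refine ge_of_tendsto hl ?_
    filter_upwards [Filter.eventually_ge_atTop (z + 1)] with x hx
    exact hm.monotoneOn (by simp) (by simp; linarith) hx
  linarith

lemma ntail_pos (z : ℝ) : 0 < ntail z := by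
  have := neg_of_deriv_pos (f := fun x => -ntail x) (f' := npdf) (z := z)
    (fun x _ => (ntail_hasDerivAt x).neg.congr_deriv (neg_neg _)) (fun x _ => npdf_pos x)
    (by simpa using ntail_tendsto.neg)
  simpa using this

/-- Sampford's bound. -/
lemma sampford (z : ℝ) (hz : -1 < z) :
    ntail z - npdf z * (4 / (3 * z + √(z ^ 2 + 8))) < 0 := by
  have hG : ∀ x : ℝ, -1 < x → 0 < 3 * x + √(x ^ 2 + 8) := by
    intro x hx
    rcases le_or_gt 0 x with h | h
    · positivity
    · have : -(3 * x) < √(x ^ 2 + 8) := Real.lt_sqrt_of_sq_lt (by nlinarith)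
      linarith
  refine neg_of_deriv_pos (f := fun x => ntail x - npdf x * (4 / (3 * x + √(x ^ 2 + 8))))
    (f' := fun x => npdf x * (x * (4 / (3 * x + √(x ^ 2 + 8)))
      + 4 * (3 + x / √(x ^ 2 + 8)) / (3 * x + √(x ^ 2 + 8)) ^ 2 - 1)) ?_ ?_ ?_
  · intro x hx
    have hg := hG x (by linarith)
    have hs : HasDerivAt (fun x : ℝ => √(x ^ 2 + 8)) (x / √(x ^ 2 + 8)) x := by
      have h0 : HasDerivAt (fun x : ℝ => x ^ 2 + 8) (2 * x) x := by
        simpa using (hasDerivAt_pow 2 x).add_const 8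
      convert h0.sqrt (by positivity) using 1
      field_simp
    have h3 : HasDerivAt (fun x : ℝ => 3 * x) 3 x := by
      simpa using (hasDerivAt_id x).const_mul 3
    have h4 := (hasDerivAt_const x (4:ℝ)).div (h3.add hs) hg.ne'
    have h5 := (ntail_hasDerivAt x).sub ((npdf_hasDerivAt x).mul h4)
    refine HasDerivAt.congr_deriv h5 ?_
    simp only [Pi.add_apply, Pi.div_apply]
    ring
  · intro x hx
    have hg := hG x (by linarith)
    refine mul_pos (npdf_pos x) ?_
    have hs : 0 < √(x ^ 2 + 8) := by positivity
    have hs2 : √(x ^ 2 + 8) ^ 2 = x ^ 2 + 8 := Real.sq_sqrt (by positivity)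
    have key : x ^ 3 + 6 * x < √(x ^ 2 + 8) * (x ^ 2 + 2) := by
      apply lt_of_pow_lt_pow_left₀ 2 (by positivity)
      rw [mul_pow, hs2]
      nlinarith
    generalize √(x ^ 2 + 8) = s at *
    have : x * (4 / (3 * x + s)) + 4 * (3 + x / s) / (3 * x + s) ^ 2 - 1
        = 2 * (s * (x ^ 2 + 2) - (x ^ 3 + 6 * x)) / (s * (3 * x + s) ^ 2) := by
      have hs' := hs.ne'
      obtain ⟨G, hGd⟩ : ∃ G, G = 3 * x + s := ⟨_, rfl⟩
      rw [← hGd] at hg ⊢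
      have hg' := hg.ne'
      field_simp
      rw [hGd]
      linear_combination (-2 * x - s) * hs2
    rw [this]
    have : 0 < s * (x ^ 2 + 2) - (x ^ 3 + 6 * x) := by linarith
    positivity
  · have h1 : Filter.Tendsto (fun x => npdf x * (4 / (3 * x + √(x ^ 2 + 8))))
        Filter.atTop (nhds 0) := by
      refine squeeze_zero' (g := fun x => npdf x * 4) ?_ ?_ (by simpa using npdf_tendsto.mul_const 4)
      · filter_upwards [Filter.eventually_ge_atTop 1] with x hx
        have := npdf_pos x
        positivity
      · filter_upwards [Filter.eventually_ge_atTop 1] with x hx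
        have := npdf_pos x
        have h2 : 4 / (3 * x + √(x ^ 2 + 8)) ≤ 4 := by
          apply div_le_self (by norm_num)
          have := Real.sqrt_nonneg (x ^ 2 + 8)
          linarith
        gcongr
    simpa using ntail_tendsto.sub h1

/-- for every real z,
2·(φ(z)/Ψ(z))² − 3·z·(φ(z)/Ψ(z)) + z² > 1. -/
theorem millsRatio_ineq :
    ∀ z : ℝ, 1 < 2 * (npdf z / ntail z) ^ 2 - 3 * z * (npdf z / ntail z) + z ^ 2 := by
  intro z
  have hT := ntail_pos z
  have hN := npdf_pos z
  have hh : 0 < npdf z / ntail z := by positivity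
  rcases le_or_gt z (-1) with hz | hz
  · nlinarith [mul_nonneg (show 0 ≤ -z by linarith) hh.le, pow_pos hh 2]
  · have h := sampford z hz
    have hs : 0 < √(z ^ 2 + 8) := by positivity
    have hs2 : √(z ^ 2 + 8) ^ 2 = z ^ 2 + 8 := Real.sq_sqrt (by positivity)
    have hG : 0 < 3 * z + √(z ^ 2 + 8) := by
      by_contra hc
      have : 4 / (3 * z + √(z ^ 2 + 8)) ≤ 0 :=
        div_nonpos_of_nonneg_of_nonpos (by norm_num) (by linarith)
      nlinarith
    have h1 : (3 * z + √(z ^ 2 + 8)) / 4 < npdf z / ntail z := by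
      rw [lt_div_iff₀ hT]
      have h2 : ntail z < npdf z * 4 / (3 * z + √(z ^ 2 + 8)) := by
        rw [mul_div_assoc]; linarith
      rw [lt_div_iff₀ hG] at h2
      linarith
    generalize √(z ^ 2 + 8) = s at *
    generalize npdf z / ntail z = r at *
    nlinarith [mul_pos (sub_pos.2 h1) (show 0 < r - (3 * z - s) / 4 by linarith)]
end

section
/- Define λ*(p) := √(2r)·φ(√(2r)·v(p))·(2b/(1−b))·((1−p)/p) for p ∈ (0,b). Then for every p ∈ (0,b) one has the identity λ*(p)·p − r·u(p) = (2b − M·√(rπ))·√(2r)·((1−p)/(1−b))·φ(√(2r)·v(p)) + (M·√(rπ) − b)·r·p·v(p)/b, and consequently (using M ≤ √π/(2√r)) the inequality r·u(p) ≤ λ*(p)·p holds for every p ∈ (0,b). -/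
/-- with λ*(p) = √(2r)·φ(√(2r)·v(p))·(2b/(1−b))·((1−p)/p), for every
p ∈ (0,b) one has
λ*(p)·p − r·u(p) = (2b − M√(rπ))·√(2r)·((1−p)/(1−b))·φ(√(2r)·v(p)) + (M√(rπ) − b)·r·p·v(p)/b,
and consequently r·u(p) ≤ λ*(p)·p. -/
theorem lambda_identity (r M b : ℝ) (v u lam : ℝ → ℝ) (hr : 0 < r) (hM : 0 < M)
    (hMle : M ≤ Real.sqrt Real.pi / (2 * Real.sqrt r))
    (hb : b = M * Real.pi * Real.sqrt r / (Real.sqrt Real.pi + 2 * M * Real.sqrt r))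
    (hv : ∀ p ∈ Set.Ioo (0:ℝ) b, 0 < v p ∧
      ntail (Real.sqrt (2*r) * v p) = (1 - b) * p / (2 * b * (1 - p)))
    (hu : ∀ p ∈ Set.Ioo (0:ℝ) b, u p =
      p * v p + M * Real.sqrt (2 * Real.pi) * ((1 - p) / (1 - b))
        * Fstat (Real.sqrt (2*r) * v p))
    (hlam : ∀ p ∈ Set.Ioo (0:ℝ) b, lam p =
      Real.sqrt (2*r) * npdf (Real.sqrt (2*r) * v p) * (2 * b / (1 - b)) * ((1 - p) / p)) :
    ∀ p ∈ Set.Ioo (0:ℝ) b,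
      lam p * p - r * u p =
        (2 * b - M * Real.sqrt (r * Real.pi)) * Real.sqrt (2*r) * ((1 - p) / (1 - b))
          * npdf (Real.sqrt (2*r) * v p)
        + (M * Real.sqrt (r * Real.pi) - b) * r * p * v p / b ∧
      r * u p ≤ lam p * p := by
  intro p hp
  obtain ⟨hvp, ht⟩ := hv p hp
  have hp0 := hp.1
  have hpb := hp.2
  have hpi := Real.pi_pos
  have hpi4 := Real.pi_lt_four
  have h2r : Real.sqrt (2*r) = Real.sqrt 2 * Real.sqrt r := Real.sqrt_mul (by norm_num) r
  have h2p : Real.sqrt (2*Real.pi) = Real.sqrt 2 * Real.sqrt Real.pi :=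
    Real.sqrt_mul (by norm_num) _
  have hrp : Real.sqrt (r*Real.pi) = Real.sqrt r * Real.sqrt Real.pi :=
    Real.sqrt_mul hr.le _
  have hphi : 0 < npdf (Real.sqrt (2*r) * v p) := by unfold npdf; positivity
  have e1 := hu p hp
  have e2 := hlam p hp
  unfold Fstat at e1
  rw [ht] at e1
  generalize npdf (Real.sqrt (2*r) * v p) = f at *
  rw [h2r, h2p] at e1
  rw [h2r] at e2
  rw [h2r, hrp]
  have ht2 : Real.sqrt 2 ^ 2 = 2 := Real.sq_sqrt (by norm_num)
  have hq2 : Real.sqrt r ^ 2 = r := Real.sq_sqrt hr.le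
  have hs2 : Real.sqrt Real.pi ^ 2 = Real.pi := Real.sq_sqrt hpi.le
  have ht0 : 0 < Real.sqrt 2 := by positivity
  have hq0 : 0 < Real.sqrt r := by positivity
  have hs0 : 0 < Real.sqrt Real.pi := by positivity
  clear h2r h2p hrp ht hv hu hlam
  generalize Real.sqrt 2 = t at *
  generalize Real.sqrt r = q at *
  generalize Real.sqrt Real.pi = s at *
  have hm : 2 * (M * q) ≤ s := by
    rw [le_div_iff₀ (by positivity)] at hMle
    linarith
  have hMq : 0 < M * q := by positivity
  have hD : 0 < s + 2 * M * q := by positivity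
  have hb' : b * (s + 2 * M * q) = M * q * s ^ 2 := by
    rw [hb, hs2]; field_simp
  have hb0 : 0 < b := by linarith
  have hb1 : b < 1 := by
    have : b * (s + 2 * M * q) < 1 * (s + 2 * M * q) := by
      rw [hb']
      nlinarith
    exact lt_of_mul_lt_mul_right this hD.le
  have h1b : 0 < 1 - b := by linarith
  have h1p : 0 < 1 - p := by linarith
  have hA : 0 ≤ 2 * b - M * (q * s) := by
    have : 0 ≤ (2 * b - M * (q * s)) * (s + 2 * M * q) := by
      have : (2 * b - M * (q * s)) * (s + 2 * M * q) = M * q * s * (s - 2 * (M * q)) := by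
        linear_combination 2 * hb'
      rw [this]
      exact mul_nonneg (by positivity) (by linarith)
    exact nonneg_of_mul_nonneg_left this hD
  have hB : 0 ≤ M * (q * s) - b := by
    have : 0 ≤ (M * (q * s) - b) * (s + 2 * M * q) := by
      have : (M * (q * s) - b) * (s + 2 * M * q) = M * q * s * (2 * (M * q)) := by
        linear_combination -hb'
      rw [this]
      positivity
    exact nonneg_of_mul_nonneg_left this hD
  have key : lam p * p - r * u p =
        (2 * b - M * (q * s)) * (t * q) * ((1 - p) / (1 - b)) * f
        + (M * (q * s) - b) * r * p * v p / b := by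
    rw [e1, e2, ← hq2]
    clear hb hb' e1 e2
    field_simp
    linear_combination (p * v p * M * q ^ 2 * s * (1 - b)) * ht2
  refine ⟨key, ?_⟩
  have h1 : 0 ≤ (2 * b - M * (q * s)) * (t * q) * ((1 - p) / (1 - b)) * f := by positivity
  have h2 : 0 ≤ (M * (q * s) - b) * r * p * v p / b := by positivity
  linarith
end
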